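/- Let 𝒜 : ℝ^{M×N} → ℝ^{M×N} be the linear operator 𝒜(V) = Σ_{i=1}^{p} A_i V B_iᵀ with A_i ∈ ℝ^{M×M}, B_i ∈ ℝ^{N×N}, and suppose 𝒜 is self-adjoint with respect to the Frobenius inner product and satisfies γ‖V‖_F² ≤ ⟨V, 𝒜(V)⟩_F ≤ Γ‖V‖_F² for all V, where 0 < γ < Γ. Let C ∈ ℝ^{M×N} with rank(C) ≤ p and let U be the (unique) solution of 𝒜(U) = C. Then with q = (Γ−γ)/(Γ+γ), for every integer r ≥ 1: τ_r(U) ≤ (‖U‖_F / q) · (1/r)^{ln(1/q)/ln(p+2)}. -/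

import Mathlib

open Matrix

/-- Frobenius inner product of real matrices. -/
noncomputable def frobInner {M N : ℕ} (X Y : Matrix (Fin M) (Fin N) ℝ) : ℝ :=
  ∑ i, ∑ j, X i j * Y i j

/-- Frobenius norm of a real matrix. -/
noncomputable def frobNorm {M N : ℕ} (X : Matrix (Fin M) (Fin N) ℝ) : ℝ :=
  Real.sqrt (frobInner X X)

/-- Best rank-`r` approximation error in the Frobenius norm. -/
noncomputable def tau {M N : ℕ} (r : ℕ) (U : Matrix (Fin M) (Fin N) ℝ) : ℝ :=
  sInf {x : ℝ | ∃ V : Matrix (Fin M) (Fin N) ℝ, V.rank ≤ r ∧ x = frobNorm (U - V)}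

section FrobeniusInner

variable {M N : ℕ}

theorem frobInner_comm (X Y : Matrix (Fin M) (Fin N) ℝ) : frobInner X Y = frobInner Y X := by
  simp only [frobInner, mul_comm]

theorem frobInner_add_left (X Y Z : Matrix (Fin M) (Fin N) ℝ) :
    frobInner (X + Y) Z = frobInner X Z + frobInner Y Z := by
  simp only [frobInner, Matrix.add_apply, add_mul, Finset.sum_add_distrib]

theorem frobInner_smul_left (c : ℝ) (X Z : Matrix (Fin M) (Fin N) ℝ) :
    frobInner (c • X) Z = c * frobInner X Z := by
  simp only [frobInner, Matrix.smul_apply, smul_eq_mul, Finset.mul_sum, mul_assoc]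

theorem frobInner_add_right (X Y Z : Matrix (Fin M) (Fin N) ℝ) :
    frobInner Z (X + Y) = frobInner Z X + frobInner Z Y := by
  simp only [frobInner_comm Z, frobInner_add_left]

theorem frobInner_smul_right (c : ℝ) (X Z : Matrix (Fin M) (Fin N) ℝ) :
    frobInner Z (c • X) = c * frobInner Z X := by
  simp only [frobInner_comm Z, frobInner_smul_left]

theorem frobInner_self_nonneg (X : Matrix (Fin M) (Fin N) ℝ) : 0 ≤ frobInner X X :=
  Finset.sum_nonneg fun _ _ => Finset.sum_nonneg fun _ _ => mul_self_nonneg _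

theorem frobNorm_sq (X : Matrix (Fin M) (Fin N) ℝ) : frobNorm X ^ 2 = frobInner X X :=
  Real.sq_sqrt (frobInner_self_nonneg X)

theorem frobNorm_nonneg (X : Matrix (Fin M) (Fin N) ℝ) : 0 ≤ frobNorm X :=
  Real.sqrt_nonneg _

/-- A self-adjoint operator whose numerical range lies in `[-q, q]` has norm at most `q`. -/
theorem frobNorm_apply_le_of_abs_frobInner_le
    (T : Matrix (Fin M) (Fin N) ℝ →ₗ[ℝ] Matrix (Fin M) (Fin N) ℝ)
    (hT : ∀ X Y, frobInner (T X) Y = frobInner X (T Y)) {q : ℝ} (hq : 0 < q)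
    (hbound : ∀ V, |frobInner V (T V)| ≤ q * frobInner V V) (V : Matrix (Fin M) (Fin N) ℝ) :
    frobNorm (T V) ≤ q * frobNorm V := by
  have h₁ := (abs_le.1 (hbound (q • V + T V))).2
  have h₂ := (abs_le.1 (hbound (q • V + (-1 : ℝ) • T V))).1
  simp only [map_add, map_smul, frobInner_add_left, frobInner_add_right, frobInner_smul_left,
    frobInner_smul_right] at h₁ h₂
  rw [← hT V (T V)] at h₁ h₂
  rw [frobInner_comm (T V) V] at h₁ h₂
  have key : frobInner (T V) (T V) ≤ q ^ 2 * frobInner V V := by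
    refine le_of_mul_le_mul_left ?_ hq
    nlinarith
  refine le_of_sq_le_sq ?_ (mul_nonneg hq.le (frobNorm_nonneg V))
  rw [mul_pow, frobNorm_sq, frobNorm_sq]
  exact key

theorem tau_le_of_rank_le {r : ℕ} (U : Matrix (Fin M) (Fin N) ℝ)
    {V : Matrix (Fin M) (Fin N) ℝ} (hV : V.rank ≤ r) : tau r U ≤ frobNorm (U - V) := by
  refine csInf_le ⟨0, ?_⟩ ⟨V, hV, rfl⟩
  rintro x ⟨W, -, rfl⟩
  exact frobNorm_nonneg _

end FrobeniusInner

section KroneckerOperator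

variable {M N p : ℕ}

/-- The operator `V ↦ ∑ i, A i * V * (B i)ᵀ` as a linear map. -/
noncomputable def kroneckerSum (A : Fin p → Matrix (Fin M) (Fin M) ℝ)
    (B : Fin p → Matrix (Fin N) (Fin N) ℝ) :
    Matrix (Fin M) (Fin N) ℝ →ₗ[ℝ] Matrix (Fin M) (Fin N) ℝ where
  toFun V := ∑ i, A i * V * (B i)ᵀ
  map_add' X Y := by simp only [Matrix.mul_add, Matrix.add_mul, Finset.sum_add_distrib]
  map_smul' c X := by
    simp only [Matrix.mul_smul, Matrix.smul_mul, Finset.smul_sum, RingHom.id_apply]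

theorem matrix_rank_add_le (X Y : Matrix (Fin M) (Fin N) ℝ) :
    (X + Y).rank ≤ X.rank + Y.rank := by
  have h := LinearMap.rank_add_le X.mulVecLin Y.mulVecLin
  rw [← Matrix.mulVecLin_add] at h
  simp only [LinearMap.rank, ← Module.finrank_eq_rank] at h
  unfold Matrix.rank
  exact_mod_cast h

theorem rank_sum_le {ι : Type*} (s : Finset ι) (f : ι → Matrix (Fin M) (Fin N) ℝ) :
    (∑ i ∈ s, f i).rank ≤ ∑ i ∈ s, (f i).rank :=
  Finset.le_sum_of_subadditive (fun X : Matrix (Fin M) (Fin N) ℝ => X.rank) Matrix.rank_zero.le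
    matrix_rank_add_le s f

theorem rank_kroneckerSum_le (A : Fin p → Matrix (Fin M) (Fin M) ℝ)
    (B : Fin p → Matrix (Fin N) (Fin N) ℝ) (V : Matrix (Fin M) (Fin N) ℝ) :
    (kroneckerSum A B V).rank ≤ p * V.rank := by
  refine (rank_sum_le Finset.univ fun i => A i * V * (B i)ᵀ).trans ?_
  have h : ∀ i, (A i * V * (B i)ᵀ).rank ≤ V.rank := fun i =>
    (Matrix.rank_mul_le_left _ _).trans (Matrix.rank_mul_le_right _ _)
  simpa using Finset.sum_le_card_nsmul Finset.univ _ V.rank fun i _ => h i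

theorem rank_const_smul_le (c : ℝ) (V : Matrix (Fin M) (Fin N) ℝ) :
    (c • V).rank ≤ V.rank := by
  simpa using Matrix.rank_mul_le_right (c • (1 : Matrix (Fin M) (Fin M) ℝ)) V

/-- After `n` Richardson steps started at zero, the iterate has rank less than `(p + 1) ^ n` and
error at most `q ^ n * ‖U‖`, where `q` bounds the norm of `1 - α 𝒜`. -/
theorem exists_rank_lt_frobNorm_sub_le (A : Fin p → Matrix (Fin M) (Fin M) ℝ)
    (B : Fin p → Matrix (Fin N) (Fin N) ℝ) {α q : ℝ} (hq : 0 ≤ q)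
    (hcontr : ∀ V, frobNorm (V - α • kroneckerSum A B V) ≤ q * frobNorm V)
    (U : Matrix (Fin M) (Fin N) ℝ) (hrank : (kroneckerSum A B U).rank ≤ p) (n : ℕ) :
    ∃ V : Matrix (Fin M) (Fin N) ℝ,
      V.rank < (p + 1) ^ n ∧ frobNorm (U - V) ≤ q ^ n * frobNorm U := by
  induction n with
  | zero => exact ⟨0, by simp⟩
  | succ n ih =>
    obtain ⟨V, hV, hUV⟩ := ih
    refine ⟨V + ((-α) • kroneckerSum A B V + α • kroneckerSum A B U), ?_, ?_⟩
    · have h₁ := matrix_rank_add_le V ((-α) • kroneckerSum A B V + α • kroneckerSum A B U)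
      have h₂ := matrix_rank_add_le ((-α) • kroneckerSum A B V) (α • kroneckerSum A B U)
      have h₃ := (rank_const_smul_le (-α) (kroneckerSum A B V)).trans (rank_kroneckerSum_le A B V)
      have h₄ := (rank_const_smul_le α (kroneckerSum A B U)).trans hrank
      have h₅ : (p + 1) * (V.rank + 1) ≤ (p + 1) * (p + 1) ^ n := Nat.mul_le_mul_left _ hV
      rw [pow_succ']
      linarith
    · have hstep : U - (V + ((-α) • kroneckerSum A B V + α • kroneckerSum A B U)) =
          (U - V) - α • kroneckerSum A B (U - V) := by
        rw [map_sub]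
        module
      rw [hstep, pow_succ', mul_assoc]
      exact (hcontr _).trans (mul_le_mul_of_nonneg_left hUV hq)

end KroneckerOperator

theorem pow_le_one_div_rpow_log_div_log {q b : ℝ} {r n : ℕ} (hq : 0 < q) (hq₁ : q ≤ 1)
    (hb : 1 < b) (hr : 1 ≤ r) (hrn : (r : ℝ) ≤ b ^ n) :
    q ^ n ≤ ((1 : ℝ) / r) ^ (Real.log (1 / q) / Real.log b) := by
  have hr₀ : (0 : ℝ) < r := by exact_mod_cast hr
  have hlb : 0 < Real.log b := Real.log_pos hb
  have hlq : Real.log q ≤ 0 := Real.log_nonpos hq.le hq₁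
  have hlr : Real.log r ≤ n * Real.log b := by
    rw [← Real.log_pow]
    exact Real.log_le_log hr₀ hrn
  rw [← Real.log_le_log_iff (pow_pos hq n) (by positivity), Real.log_rpow (by positivity),
    Real.log_pow, one_div, one_div, Real.log_inv, Real.log_inv]
  rw [show -Real.log q / Real.log b * -Real.log r = Real.log q * Real.log r / Real.log b by ring,
    le_div_iff₀ hlb]
  nlinarith

/-- singular value tail decay for the solution of a linear matrix
equation with a self-adjoint coercive operator of Kronecker rank `p` and
right-hand side of rank at most `p`. -/
theorem tau_decay_linear_equation
    {M N p : ℕ}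
    (A : Fin p → Matrix (Fin M) (Fin M) ℝ)
    (B : Fin p → Matrix (Fin N) (Fin N) ℝ)
    (opA : Matrix (Fin M) (Fin N) ℝ → Matrix (Fin M) (Fin N) ℝ)
    (hopA : ∀ V, opA V = ∑ i, A i * V * (B i)ᵀ)
    (hself : ∀ X Y : Matrix (Fin M) (Fin N) ℝ, frobInner (opA X) Y = frobInner X (opA Y))
    (γ Γ : ℝ) (hγ : 0 < γ) (hγΓ : γ < Γ)
    (hlow : ∀ V : Matrix (Fin M) (Fin N) ℝ, γ * (frobNorm V) ^ 2 ≤ frobInner V (opA V))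
    (hup : ∀ V : Matrix (Fin M) (Fin N) ℝ, frobInner V (opA V) ≤ Γ * (frobNorm V) ^ 2)
    (C : Matrix (Fin M) (Fin N) ℝ) (hC : C.rank ≤ p)
    (U : Matrix (Fin M) (Fin N) ℝ) (hU : opA U = C)
    (r : ℕ) (hr : 1 ≤ r) :
    tau r U ≤ (frobNorm U / ((Γ - γ) / (Γ + γ))) *
      ((1 : ℝ) / r) ^ (Real.log (1 / ((Γ - γ) / (Γ + γ))) / Real.log ((p : ℝ) + 2)) := by
  obtain rfl : opA = kroneckerSum A B := funext hopA
  have hΓ : 0 < Γ + γ := by linarith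
  set q := (Γ - γ) / (Γ + γ) with hqdef
  have hq : 0 < q := div_pos (by linarith) hΓ
  have hq₁ : q ≤ 1 := (div_le_one hΓ).2 (by linarith)
  have hcontr : ∀ V, frobNorm (V - (2 / (Γ + γ)) • kroneckerSum A B V) ≤ q * frobNorm V := by
    intro V
    have hT : ∀ W, (LinearMap.id + (-(2 / (Γ + γ))) • kroneckerSum A B :
        Matrix (Fin M) (Fin N) ℝ →ₗ[ℝ] Matrix (Fin M) (Fin N) ℝ) W =
        W + (-(2 / (Γ + γ))) • kroneckerSum A B W := fun _ => rfl
    have h := frobNorm_apply_le_of_abs_frobInner_le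
      (LinearMap.id + (-(2 / (Γ + γ))) • kroneckerSum A B) (fun X Y => by
        simp only [hT, frobInner_add_left, frobInner_add_right, frobInner_smul_left,
          frobInner_smul_right, hself]) hq (fun W => by
        have h₁ := hlow W
        have h₂ := hup W
        rw [frobNorm_sq] at h₁ h₂
        simp only [hT, frobInner_add_right, frobInner_smul_right]
        have hcancel : frobInner W W + -(2 / (Γ + γ)) * frobInner W (kroneckerSum A B W) =
            ((Γ + γ) * frobInner W W - 2 * frobInner W (kroneckerSum A B W)) / (Γ + γ) := by
          field_simp
          ring
        rw [hcancel, hqdef, div_mul_eq_mul_div, abs_div, abs_of_pos hΓ]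
        refine div_le_div_of_nonneg_right (abs_le.2 ⟨?_, ?_⟩) hΓ.le <;> linarith) V
    rwa [hT, neg_smul, ← sub_eq_add_neg] at h
  obtain ⟨V, hV, hUV⟩ := exists_rank_lt_frobNorm_sub_le A B hq.le hcontr U (hU ▸ hC)
    (Nat.log (p + 2) r)
  have hVr : V.rank ≤ r :=
    hV.le.trans ((Nat.pow_le_pow_left (by omega) _).trans
      (Nat.pow_log_le_self (p + 2) (by omega)))
  have hrn : (r : ℝ) ≤ ((p : ℝ) + 2) ^ (Nat.log (p + 2) r + 1) := by
    exact_mod_cast (Nat.lt_pow_succ_log_self (by omega : 1 < p + 2) r).le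
  have hpow := pow_le_one_div_rpow_log_div_log hq hq₁
    (by have := Nat.cast_nonneg (α := ℝ) p; linarith) hr hrn
  calc tau r U ≤ frobNorm (U - V) := tau_le_of_rank_le U hVr
    _ ≤ q ^ Nat.log (p + 2) r * frobNorm U := hUV
    _ = frobNorm U / q * q ^ (Nat.log (p + 2) r + 1) := by
      rw [pow_succ]
      field_simp
    _ ≤ _ := mul_le_mul_of_nonneg_left hpow (div_nonneg (frobNorm_nonneg U) hq.le)
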